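/- Let n ≥ 2 and let Σ be a finite set of n×n real matrices such that ‖Ax‖_P ≤ ‖x‖_P for every A ∈ Σ and every x ∈ ℝ^n. If there exists a sequence σ : ℕ → Σ that is noncontracting, then there exist matrices B_1, …, B_p ∈ Σ with 1 ≤ p ≤ (3^n − 2^{n+1} + 1)/2 such that for every k ≥ 1 the power (B_p ⋯ B_1)^k does not contract ‖·‖_P. -/

import Mathlib

open Filter Matrix

/-- The seminorm `‖x‖_P = (1/2)(max_i x_i − min_i x_i)`. -/
noncomputable def normP {n : ℕ} (x : Fin n → ℝ) : ℝ :=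
  (1 / 2) * ((⨆ i, x i) - ⨅ i, x i)

/-- A matrix `M` contracts `‖·‖_P` if `‖Mx‖_P < 1` whenever `‖x‖_P ≤ 1`. -/
noncomputable def ContractsP {n : ℕ} (M : Matrix (Fin n) (Fin n) ℝ) : Prop :=
  ∀ x : Fin n → ℝ, normP x ≤ 1 → normP (M.mulVec x) < 1

/-- Partial products `P t = σ(t) ⋯ σ(1)` of a sequence of matrices (P 0 = identity). -/
def partialProd {n : ℕ} (σ : ℕ → Matrix (Fin n) (Fin n) ℝ) : ℕ → Matrix (Fin n) (Fin n) ℝ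
  | 0 => 1
  | t + 1 => σ (t + 1) * partialProd σ t

/-- The bound `p*(n) = C(n, ⌊n/3⌋) · (2^(n − ⌊n/3⌋ − 1) − 1)`. -/
def pstar (n : ℕ) : ℕ := n.choose (n / 3) * (2 ^ (n - n / 3 - 1) - 1)

theorem normP_le_iff {n : ℕ} [NeZero n] {x : Fin n → ℝ} {c : ℝ} :
    normP x ≤ c ↔ ∀ i j, x i - x j ≤ 2 * c := by
  have hsup := (Set.finite_range x).bddAbove
  have hinf := (Set.finite_range x).bddBelow
  constructor
  · intro h i j
    have h₁ := le_ciSup hsup i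
    have h₂ := ciInf_le hinf j
    unfold normP at h
    linarith
  · intro h
    have h₁ : (⨆ i, x i) ≤ (⨅ j, x j) + 2 * c := by
      refine ciSup_le fun i => ?_
      have h₂ : x i - 2 * c ≤ ⨅ j, x j := le_ciInf fun j => by linarith [h i j]
      linarith
    unfold normP
    linarith

/-- The pairs of coordinates of `x` whose difference is at least `2`. When `normP x ≤ 1` they
determine the open face of the unit ball containing `x`. -/
def extremalPairs {n : ℕ} (x : Fin n → ℝ) : Set (Fin n × Fin n) :=
  {q | 2 ≤ x q.1 - x q.2}

theorem one_le_normP_iff {n : ℕ} [NeZero n] {x : Fin n → ℝ} :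
    1 ≤ normP x ↔ (extremalPairs x).Nonempty := by
  constructor
  · intro h
    obtain ⟨i, hi⟩ := exists_eq_ciSup_of_finite (f := x)
    obtain ⟨j, hj⟩ := exists_eq_ciInf_of_finite (f := x)
    refine ⟨(i, j), ?_⟩
    unfold normP at h
    simp only [extremalPairs, Set.mem_ofPred_eq, hi, hj]
    linarith
  · rintro ⟨⟨i, j⟩, h⟩
    have h₁ := normP_le_iff.1 (le_refl (normP x)) i j
    simp only [extremalPairs, Set.mem_ofPred_eq] at h
    linarith

theorem normP_neg {n : ℕ} [NeZero n] (x : Fin n → ℝ) : normP (-x) = normP x := by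
  refine le_antisymm (normP_le_iff.2 fun i j => ?_) (normP_le_iff.2 fun i j => ?_)
  · have := normP_le_iff.1 (le_refl (normP x)) j i
    simp only [Pi.neg_apply]
    linarith
  · have := normP_le_iff.1 (le_refl (normP (-x))) j i
    simp only [Pi.neg_apply] at this
    linarith

theorem extremalPairs_neg_subset {n : ℕ} {x y : Fin n → ℝ}
    (h : extremalPairs x ⊆ extremalPairs y) : extremalPairs (-x) ⊆ extremalPairs (-y) := by
  rintro ⟨i, j⟩ hij
  have h₁ : (j, i) ∈ extremalPairs x := by
    simp only [extremalPairs, Set.mem_ofPred_eq, Pi.neg_apply] at hij ⊢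
    linarith
  have h₂ := h h₁
  simp only [extremalPairs, Set.mem_ofPred_eq, Pi.neg_apply] at h₂ ⊢
  linarith

theorem exists_normP_extrapolate_le {n : ℕ} [NeZero n] {x y : Fin n → ℝ} (hx : normP x ≤ 1)
    (h : extremalPairs x ⊆ extremalPairs y) : ∃ ε > (0 : ℝ), normP (x + ε • (x - y)) ≤ 1 := by
  have key : ∀ᶠ ε : ℝ in nhdsWithin 0 (Set.Ioi 0), ∀ q : Fin n × Fin n,
      (x q.1 - x q.2) + ε * ((x q.1 - x q.2) - (y q.1 - y q.2)) ≤ 2 := by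
    rw [eventually_all]
    intro q
    have hxq : x q.1 - x q.2 ≤ 2 := by simpa using normP_le_iff.1 hx q.1 q.2
    by_cases hq : 2 ≤ x q.1 - x q.2
    · have hyq : 2 ≤ y q.1 - y q.2 := h hq
      filter_upwards [self_mem_nhdsWithin] with ε hε
      have hε' : (0 : ℝ) < ε := hε
      nlinarith
    · have hc : Continuous fun ε : ℝ =>
          (x q.1 - x q.2) + ε * ((x q.1 - x q.2) - (y q.1 - y q.2)) := by fun_prop
      have h0 := (hc.tendsto 0).eventually_lt_const (u := 2) (by simpa using hq)
      filter_upwards [nhdsWithin_le_nhds h0] with ε hε using hε.le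
  obtain ⟨ε, hε, hpos⟩ := (key.and self_mem_nhdsWithin).exists
  refine ⟨ε, hpos, normP_le_iff.2 fun i j => ?_⟩
  have := hε (i, j)
  simp only [Pi.add_apply, Pi.smul_apply, Pi.sub_apply, smul_eq_mul]
  linarith

/-- A nonexpansive matrix respects inclusion of faces of the unit ball. -/
theorem extremalPairs_mulVec_subset {n : ℕ} [NeZero n] {M : Matrix (Fin n) (Fin n) ℝ}
    (hM : ∀ x, normP (M *ᵥ x) ≤ normP x) {x y : Fin n → ℝ} (hx : normP x ≤ 1)
    (h : extremalPairs x ⊆ extremalPairs y) :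
    extremalPairs (M *ᵥ x) ⊆ extremalPairs (M *ᵥ y) := by
  obtain ⟨ε, hε, hz⟩ := exists_normP_extrapolate_le hx h
  rintro ⟨i, j⟩ hij
  have hzij := normP_le_iff.1 ((hM _).trans hz) i j
  simp only [mulVec_add, mulVec_smul, mulVec_sub, Pi.add_apply, Pi.smul_apply, Pi.sub_apply,
    smul_eq_mul] at hzij
  simp only [extremalPairs, Set.mem_ofPred_eq] at hij ⊢
  by_contra hlt
  push Not at hlt
  nlinarith

open Classical in
/-- The sign pattern of the face containing `x`: `1` at the maximal coordinates, `-1` at the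
minimal ones. -/
noncomputable def facePattern {n : ℕ} (x : Fin n → ℝ) (i : Fin n) : SignType :=
  if ∃ j, 2 ≤ x i - x j then 1 else if ∃ j, 2 ≤ x j - x i then -1 else 0

theorem facePattern_eq_one_iff {n : ℕ} {x : Fin n → ℝ} {i : Fin n} :
    facePattern x i = 1 ↔ ∃ j, 2 ≤ x i - x j := by
  unfold facePattern
  split_ifs with h₁ h₂ <;> simp_all

theorem facePattern_eq_neg_one_iff {n : ℕ} [NeZero n] {x : Fin n → ℝ} (hx : normP x ≤ 1)
    {i : Fin n} : facePattern x i = -1 ↔ ∃ j, 2 ≤ x j - x i := by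
  unfold facePattern
  split_ifs with h₁ h₂
  · obtain ⟨j, hj⟩ := h₁
    refine iff_of_false (by decide) ?_
    rintro ⟨k, hk⟩
    linarith [normP_le_iff.1 hx k j]
  · simp_all
  · exact iff_of_false (by decide) h₂

theorem mem_extremalPairs_iff {n : ℕ} [NeZero n] {x : Fin n → ℝ} (hx : normP x ≤ 1)
    {i j : Fin n} :
    (i, j) ∈ extremalPairs x ↔ facePattern x i = 1 ∧ facePattern x j = -1 := by
  rw [facePattern_eq_one_iff, facePattern_eq_neg_one_iff hx]
  constructor
  · exact fun h => ⟨⟨j, h⟩, ⟨i, h⟩⟩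
  · rintro ⟨⟨k, hk⟩, ⟨l, hl⟩⟩
    have := normP_le_iff.1 hx l k
    simp only [extremalPairs, Set.mem_ofPred_eq]
    linarith

theorem card_signPatterns_le (n : ℕ) :
    (Finset.univ.filter fun f : Fin n → SignType => (∃ i, f i = 1) ∧ ∃ i, f i = -1).card ≤
      3 ^ n - 2 ^ (n + 1) + 1 := by
  set T := Finset.univ.filter fun f : Fin n → SignType => (∃ i, f i = 1) ∧ ∃ i, f i = -1
  set U := Fintype.piFinset fun _ : Fin n => ({0, -1} : Finset SignType)
  set V := Fintype.piFinset fun _ : Fin n => ({0, 1} : Finset SignType)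
  have hU : U.card = 2 ^ n := by simp [U]
  have hV : V.card = 2 ^ n := by simp [V]
  have hUV : (U ∩ V).card ≤ 1 := by
    refine Finset.card_le_one.2 fun f hf g hg => funext fun i => ?_
    simp only [U, V, Finset.mem_inter, Fintype.mem_piFinset] at hf hg
    have := hf.1 i; have := hf.2 i; have := hg.1 i; have := hg.2 i
    generalize f i = a at *
    generalize g i = b at *
    revert a b
    decide
  have hdisj : Disjoint T (U ∪ V) := by
    refine Finset.disjoint_left.2 fun f hf hf' => ?_
    simp only [T, Finset.mem_filter, Finset.mem_univ, true_and] at hf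
    obtain ⟨⟨i, hi⟩, ⟨j, hj⟩⟩ := hf
    simp only [U, V, Finset.mem_union, Fintype.mem_piFinset] at hf'
    rcases hf' with h | h
    · have := h i
      rw [hi] at this
      revert this
      decide
    · have := h j
      rw [hj] at this
      revert this
      decide
  have htotal : (T ∪ (U ∪ V)).card ≤ 3 ^ n := by
    refine (Finset.card_le_univ _).trans_eq ?_
    rw [Fintype.card_fun, Fintype.card_fin]
    rfl
  rw [Finset.card_union_of_disjoint hdisj] at htotal
  have := Finset.card_union_add_card_inter U V
  rw [pow_succ]
  omega

/-- Among more than half as many unit vectors as there are proper faces of the unit ball, two lie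
in equal or opposite open faces. -/
theorem exists_lt_extremalPairs_subset {n : ℕ} [NeZero n] (v : ℕ → Fin n → ℝ)
    (hle : ∀ t, normP (v t) ≤ 1) (hge : ∀ t, 1 ≤ normP (v t)) :
    ∃ s t, s < t ∧ t ≤ (3 ^ n - 2 ^ (n + 1) + 1) / 2 ∧
      (extremalPairs (v s) ⊆ extremalPairs (v t) ∨
        extremalPairs (v s) ⊆ extremalPairs (-v t)) := by
  set N := (3 ^ n - 2 ^ (n + 1) + 1) / 2 with hN
  let w : Fin (N + 1) × Bool → Fin n → ℝ := fun a => if a.2 then v a.1 else -v a.1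
  have hw : ∀ a, normP (w a) ≤ 1 := by
    rintro ⟨a, _ | _⟩ <;> simp [w, normP_neg, hle]
  have hw' : ∀ a, 1 ≤ normP (w a) := by
    rintro ⟨a, _ | _⟩ <;> simp [w, normP_neg, hge]
  obtain ⟨a, -, b, -, hab, heq⟩ := Finset.exists_ne_map_eq_of_card_lt_of_maps_to
    (s := (Finset.univ : Finset (Fin (N + 1) × Bool)))
    (t := Finset.univ.filter fun f : Fin n → SignType => (∃ i, f i = 1) ∧ ∃ i, f i = -1)
    (f := fun a => facePattern (w a))
    (by
      have := card_signPatterns_le n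
      simp only [Finset.card_univ, Fintype.card_prod, Fintype.card_fin, Fintype.card_bool]
      omega)
    (by
      intro a _
      obtain ⟨⟨i, j⟩, hij⟩ := one_le_normP_iff.1 (hw' a)
      obtain ⟨h₁, h₂⟩ := (mem_extremalPairs_iff (hw a)).1 hij
      simpa using ⟨⟨i, h₁⟩, ⟨j, h₂⟩⟩)
  have hE : extremalPairs (w a) = extremalPairs (w b) := by
    ext ⟨i, j⟩
    rw [mem_extremalPairs_iff (hw a), mem_extremalPairs_iff (hw b)]
    exact iff_of_eq (by rw [show facePattern (w a) = facePattern (w b) from heq])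
  have hopp : ∀ t, extremalPairs (v t) ≠ extremalPairs (-v t) := by
    intro t ht
    obtain ⟨⟨i, j⟩, hij⟩ := one_le_normP_iff.1 (hge t)
    have hij' := ht ▸ hij
    simp only [extremalPairs, Set.mem_ofPred_eq, Pi.neg_apply] at hij hij'
    linarith
  have main : ∀ a b : Fin (N + 1) × Bool, extremalPairs (w a) = extremalPairs (w b) →
      extremalPairs (v a.1) ⊆ extremalPairs (v b.1) ∨
        extremalPairs (v a.1) ⊆ extremalPairs (-v b.1) := by
    rintro ⟨a, _ | _⟩ ⟨b, _ | _⟩ h <;> simp only [w, if_true, if_false, Bool.false_eq_true] at h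
    · exact Or.inl (by simpa using extremalPairs_neg_subset h.subset)
    · exact Or.inr (by simpa using extremalPairs_neg_subset h.subset)
    · exact Or.inr h.subset
    · exact Or.inl h.subset
  have hne : a.1 ≠ b.1 := by
    rcases a with ⟨a, _ | _⟩ <;> rcases b with ⟨b, _ | _⟩ <;> rintro h <;>
      simp only [w, if_true, if_false, Bool.false_eq_true] at h hE hab <;> subst h
    · exact hab rfl
    · exact hopp _ hE.symm
    · exact hopp _ hE
    · exact hab rfl
  rcases lt_or_gt_of_ne hne with h | h
  · exact ⟨a.1, b.1, h, by omega, main a b hE⟩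
  · exact ⟨b.1, a.1, h, by omega, main b a hE.symm⟩

theorem partialProd_add {n : ℕ} (σ : ℕ → Matrix (Fin n) (Fin n) ℝ) (s p : ℕ) :
    partialProd σ (s + p) =
      (List.ofFn fun i : Fin p => σ (s + p - i)).prod * partialProd σ s := by
  induction p with
  | zero => simp
  | succ p ih =>
    have h : (fun i : Fin p => σ (s + (p + 1) - (i.succ : Fin (p + 1)))) =
        fun i : Fin p => σ (s + p - i) := by
      funext i
      congr 1
      simp only [Fin.val_succ]
      omega
    rw [List.ofFn_succ, List.prod_cons, h, mul_assoc, ← ih]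
    rfl

theorem normP_listProd_mulVec_le {n : ℕ} {l : List (Matrix (Fin n) (Fin n) ℝ)}
    (hl : ∀ A ∈ l, ∀ x, normP (A *ᵥ x) ≤ normP x) (x : Fin n → ℝ) :
    normP (l.prod *ᵥ x) ≤ normP x := by
  induction l with
  | nil => simp
  | cons A l ih =>
    rw [List.prod_cons, ← mulVec_mulVec]
    exact (hl A (by simp) _).trans (ih fun B hB => hl B (by simp [hB]))

theorem normP_partialProd_mulVec_antitone {n : ℕ} {σ : ℕ → Matrix (Fin n) (Fin n) ℝ}
    (hσ : ∀ t x, normP (σ t *ᵥ x) ≤ normP x) (x : Fin n → ℝ) :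
    Antitone fun t => normP (partialProd σ t *ᵥ x) := by
  refine antitone_nat_of_succ_le fun t => ?_
  change normP ((σ (t + 1) * partialProd σ t) *ᵥ x) ≤ _
  rw [← mulVec_mulVec]
  exact hσ _ _

/-- A noncontracting sequence of nonexpansive matrices has a single vector witnessing that no
partial product contracts. -/
theorem exists_forall_one_le_normP_partialProd {n : ℕ} [NeZero n]
    {σ : ℕ → Matrix (Fin n) (Fin n) ℝ} (hσ : ∀ t x, normP (σ t *ᵥ x) ≤ normP x)
    (hnc : ∀ t, 1 ≤ t → ¬ ContractsP (partialProd σ t)) :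
    ∃ x, normP x ≤ 1 ∧ ∀ t, 1 ≤ normP (partialProd σ t *ᵥ x) := by
  have hwit : ∀ t : ℕ, ∃ x, normP x ≤ 1 ∧ 1 ≤ normP (partialProd σ (t + 1) *ᵥ x) := by
    intro t
    simpa [ContractsP] using hnc (t + 1) (by omega)
  choose x hx hx' using hwit
  obtain ⟨F, hF⟩ := Finite.exists_infinite_fiber fun t => extremalPairs (x t)
  have hF' := Set.infinite_coe_iff.1 hF
  obtain ⟨r, hr⟩ := hF'.nonempty
  refine ⟨x r, hx r, fun t => ?_⟩
  obtain ⟨u, hu, htu⟩ := hF'.exists_gt t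
  have hsub : extremalPairs (x u) ⊆ extremalPairs (x r) := (Eq.trans hu hr.symm).subset
  have hnonexp : ∀ y, normP (partialProd σ (u + 1) *ᵥ y) ≤ normP y := fun y => by
    simpa [partialProd] using normP_partialProd_mulVec_antitone hσ y (Nat.zero_le (u + 1))
  have h₁ := one_le_normP_iff.2 ((one_le_normP_iff.1 (hx' u)).mono
    (extremalPairs_mulVec_subset hnonexp (hx u) hsub))
  exact h₁.trans (normP_partialProd_mulVec_antitone hσ (x r) (by omega))

/-- A nonexpansive matrix mapping a face of the unit ball to itself or to its opposite has no
contracting power. -/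
theorem one_le_normP_pow_mulVec {n : ℕ} [NeZero n] {M : Matrix (Fin n) (Fin n) ℝ}
    (hM : ∀ x, normP (M *ᵥ x) ≤ normP x) {y : Fin n → ℝ} (hy : normP y ≤ 1)
    (hy' : 1 ≤ normP y) (h : extremalPairs y ⊆ extremalPairs (M *ᵥ y) ∨
      extremalPairs y ⊆ extremalPairs (-(M *ᵥ y))) (k : ℕ) : 1 ≤ normP (M ^ k *ᵥ y) := by
  have key : normP (M ^ k *ᵥ y) ≤ 1 ∧ (extremalPairs y ⊆ extremalPairs (M ^ k *ᵥ y) ∨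
      extremalPairs y ⊆ extremalPairs (-(M ^ k *ᵥ y))) := by
    induction k with
    | zero => simpa using hy
    | succ k ih =>
      obtain ⟨hk, ih⟩ := ih
      rw [pow_succ', ← mulVec_mulVec]
      refine ⟨(hM _).trans hk, ?_⟩
      rcases ih with ih | ih
      · have h₁ := extremalPairs_mulVec_subset hM hy ih
        exact h.imp (fun h => h.trans h₁) fun h => h.trans (extremalPairs_neg_subset h₁)
      · have h₁ := extremalPairs_mulVec_subset hM hy ih
        rw [mulVec_neg] at h₁
        have h₂ := extremalPairs_neg_subset h₁
        rw [neg_neg] at h₂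
        exact h.symm.imp (fun h => h.trans h₂) fun h => h.trans h₁
  have hne := one_le_normP_iff.1 hy'
  rcases key.2 with h | h
  · exact one_le_normP_iff.2 (hne.mono h)
  · rw [← normP_neg]
    exact one_le_normP_iff.2 (hne.mono h)

theorem stmt3 (n : ℕ) (hn : 2 ≤ n) (Sig : Finset (Matrix (Fin n) (Fin n) ℝ))
    (hmono : ∀ A ∈ Sig, ∀ x : Fin n → ℝ, normP (A.mulVec x) ≤ normP x)
    (σ : ℕ → Matrix (Fin n) (Fin n) ℝ) (hσ : ∀ t, σ t ∈ Sig)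
    (hnc : ∀ t : ℕ, 1 ≤ t → ¬ ContractsP (partialProd σ t)) :
    ∃ p : ℕ, 1 ≤ p ∧ p ≤ (3 ^ n - 2 ^ (n + 1) + 1) / 2 ∧
      ∃ B : Fin p → Matrix (Fin n) (Fin n) ℝ, (∀ i, B i ∈ Sig) ∧
        ∀ k : ℕ, 1 ≤ k →
          ∃ x : Fin n → ℝ, normP x ≤ 1 ∧ 1 ≤ normP (((List.ofFn B).prod ^ k).mulVec x) := by
  have : NeZero n := ⟨by omega⟩
  have hσ' : ∀ t x, normP (σ t *ᵥ x) ≤ normP x := fun t => hmono _ (hσ t)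
  obtain ⟨x, hx, hxt⟩ := exists_forall_one_le_normP_partialProd hσ' hnc
  have hle : ∀ t, normP (partialProd σ t *ᵥ x) ≤ 1 := fun t => by
    refine le_trans ?_ hx
    simpa [partialProd] using normP_partialProd_mulVec_antitone hσ' x (Nat.zero_le t)
  obtain ⟨s, t, hst, htN, hsub⟩ :=
    exists_lt_extremalPairs_subset (fun t => partialProd σ t *ᵥ x) hle hxt
  obtain ⟨p, rfl⟩ := Nat.exists_eq_add_of_le hst.le
  refine ⟨p, by omega, by omega, fun i => σ (s + p - i), fun i => hσ _, fun k _ => ?_⟩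
  refine ⟨partialProd σ s *ᵥ x, hle s, one_le_normP_pow_mulVec ?_ (hle s) (hxt s) ?_ k⟩
  · refine normP_listProd_mulVec_le fun A hA => ?_
    obtain ⟨i, rfl⟩ := List.mem_ofFn.1 hA
    exact hσ' _
  · simpa only [partialProd_add σ s p, ← mulVec_mulVec] using hsub
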